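/- Let a > 1 and b ≥ 4. If a classical magic rectangle set MRS(a,b;c) exists (equivalently, a ≡ b ≡ 0 mod 2 or abc is odd), then a Γ-magic rectangle set MRS_Γ(a,b;c) exists for every abelian group Γ of order abc. -/

import Mathlib

open Finset

/-- A Γ-magic rectangle set MRS_Γ(a,b;c): c arrays of size a×b whose entries are the
elements of Γ, each appearing exactly once, with constant row sums and column sums. -/
def IsMagicRectangleSet {Γ : Type*} [AddCommGroup Γ] (a b c : ℕ)
    (x : Fin c → Fin a → Fin b → Γ) : Prop :=
  Function.Bijective (fun q : Fin c × Fin a × Fin b => x q.1 q.2.1 q.2.2) ∧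
  (∃ ω : Γ, ∀ s i, ∑ j, x s i j = ω) ∧
  (∃ δ : Γ, ∀ s j, ∑ i, x s i j = δ)

/-- Γ has more than one involution (element of order 2). -/
def HasMoreThanOneInvolution (Γ : Type*) [AddCommGroup Γ] : Prop :=
  ∃ i j : Γ, i ≠ j ∧ addOrderOf i = 2 ∧ addOrderOf j = 2

universe u

/-- Rectangles indexed by arbitrary finite types can be reindexed by `Fin`. -/
lemma exists_isMagicRectangleSet_of_types {Γ : Type*} [AddCommGroup Γ] {S I J : Type*}
    [Fintype S] [Fintype I] [Fintype J] {a b c : ℕ} (hS : Fintype.card S = c)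
    (hI : Fintype.card I = a) (hJ : Fintype.card J = b) (x : S → I → J → Γ) {ω δ : Γ}
    (hx : Function.Bijective (fun q : S × I × J => x q.1 q.2.1 q.2.2))
    (hrow : ∀ s i, ∑ j, x s i j = ω) (hcol : ∀ s j, ∑ i, x s i j = δ) :
    ∃ y : Fin c → Fin a → Fin b → Γ,
      Function.Bijective (fun q : Fin c × Fin a × Fin b => y q.1 q.2.1 q.2.2) ∧
      (∀ s i, ∑ j, y s i j = ω) ∧ (∀ s j, ∑ i, y s i j = δ) := by
  let eS := (Fintype.equivFinOfCardEq hS).symm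
  let eI := (Fintype.equivFinOfCardEq hI).symm
  let eJ := (Fintype.equivFinOfCardEq hJ).symm
  refine ⟨fun s i j => x (eS s) (eI i) (eJ j),
    hx.comp (eS.prodCongr (eI.prodCongr eJ)).bijective, fun s i => ?_, fun s j => ?_⟩
  · rw [← hrow (eS s) (eI i)]
    exact Equiv.sum_comp eJ _
  · rw [← hcol (eS s) (eJ j)]
    exact Equiv.sum_comp eI (fun i => x (eS s) i (eJ j))

/-- Every abelian group of order `a * b * c` has a magic rectangle set all of whose row and
column sums vanish. -/
def HasZeroMagicSets (a b c : ℕ) : Prop :=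
  ∀ (Γ : Type u) [AddCommGroup Γ] [Fintype Γ], Fintype.card Γ = a * b * c →
    ∃ x : Fin c → Fin a → Fin b → Γ,
      Function.Bijective (fun q : Fin c × Fin a × Fin b => x q.1 q.2.1 q.2.2) ∧
      (∀ s i, ∑ j, x s i j = 0) ∧ (∀ s j, ∑ i, x s i j = 0)

lemma HasZeroMagicSets.transpose {a b c : ℕ} (h : HasZeroMagicSets.{u} a b c) :
    HasZeroMagicSets.{u} b a c := by
  intro Γ _ _ hΓ
  obtain ⟨x, hx, hr, hc⟩ := h Γ (by rw [hΓ, mul_comm a b])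
  exact ⟨fun s i j => x s j i,
    hx.comp ((Equiv.refl _).prodCongr (Equiv.prodComm _ _)).bijective, hc, hr⟩

lemma eq_zero_of_two_nsmul_eq_zero {Γ : Type*} [AddCommGroup Γ] [Fintype Γ]
    (h : Odd (Fintype.card Γ)) {g : Γ} (hg : 2 • g = 0) : g = 0 := by
  have h1 := addOrderOf_dvd_of_nsmul_eq_zero hg
  have h2 : addOrderOf g ∣ Fintype.card Γ := addOrderOf_dvd_card
  have h3 : addOrderOf g ∣ 1 := by
    rw [← (Nat.coprime_two_left.2 h)]
    exact Nat.dvd_gcd h1 h2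
  exact AddMonoid.addOrderOf_eq_one_iff.1 (Nat.dvd_one.1 h3)

lemma sum_univ_eq_zero_of_odd_card {Γ : Type*} [AddCommGroup Γ] [Fintype Γ]
    (h : Odd (Fintype.card Γ)) : ∑ g : Γ, g = 0 := by
  apply eq_zero_of_two_nsmul_eq_zero h
  have h1 : ∑ g : Γ, g = -∑ g : Γ, g := by
    rw [← Finset.sum_neg_distrib]
    exact (Equiv.sum_comp (Equiv.neg Γ) (fun g => g)).symm
  rw [two_nsmul]
  nth_rewrite 1 [h1]
  simp

/-- An array over a quotient with zero row and column sums lifts to one with the same property. -/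
lemma exists_zero_sum_lift {Γ : Type*} [AddCommGroup Γ] (H : AddSubgroup Γ) {I J : Type*}
    [Fintype I] [Fintype J] [Nonempty I] [Nonempty J] (x : I → J → Γ ⧸ H)
    (hrow : ∀ i, ∑ j, x i j = 0) (hcol : ∀ j, ∑ i, x i j = 0) :
    ∃ r : I → J → Γ, (∀ i j, (r i j : Γ ⧸ H) = x i j) ∧
      (∀ i, ∑ j, r i j = 0) ∧ (∀ j, ∑ i, r i j = 0) := by
  classical
  let i₀ : I := Classical.arbitrary I
  let j₀ : J := Classical.arbitrary J
  obtain ⟨r, hr, hr0⟩ : ∃ r : I → J → Γ, (∀ i j, (r i j : Γ ⧸ H) = x i j) ∧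
      ∀ i, ∑ j, r i j = 0 := by
    refine ⟨fun i j => (x i j).out - if j = j₀ then ∑ k, (x i k).out else 0, fun i j => ?_,
      fun i => by simp [Finset.sum_sub_distrib]⟩
    dsimp only
    split_ifs
    · have : ((∑ k, (x i k).out : Γ) : Γ ⧸ H) = 0 := by
        rw [← QuotientAddGroup.mk'_apply, map_sum]
        simpa using hrow i
      rw [QuotientAddGroup.mk_sub, this]
      simp
    · simp
  refine ⟨fun i j => r i j - if i = i₀ then ∑ k, r k j else 0, fun i j => ?_, fun i => ?_,
    fun j => by simp [Finset.sum_sub_distrib]⟩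
  · dsimp only
    split_ifs
    · have : ((∑ k, r k j : Γ) : Γ ⧸ H) = 0 := by
        rw [← QuotientAddGroup.mk'_apply, map_sum]
        simpa [hr] using hcol j
      rw [QuotientAddGroup.mk_sub, this, hr]
      simp
    · simp [hr]
  · rw [Finset.sum_sub_distrib, hr0]
    split_ifs
    · rw [Finset.sum_comm]
      simp [hr0]
    · simp

lemma exists_extend_by_signs {n : ℕ} (f : Fin n → ℤ) (m : ℕ) :
    ∃ g : Fin (n + 2 * m) → ℤ, ∑ i, g i = ∑ i, f i ∧
      ∀ i, g i = 1 ∨ g i = -1 ∨ ∃ j, g i = f j := by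
  refine ⟨Fin.append f (fun i : Fin (2 * m) => (-1) ^ (i : ℕ)), ?_, fun i => ?_⟩
  · rw [Fin.sum_univ_add]
    simp only [Fin.append_left, Fin.append_right]
    rw [Fin.sum_univ_eq_sum_range (fun i => (-1 : ℤ) ^ i), neg_one_geom_sum]
    simp
  · refine Fin.addCases (fun j => ?_) (fun j => ?_) i
    · right; right
      exact ⟨j, Fin.append_left _ _ _⟩
    · rw [Fin.append_right]
      rcases neg_one_pow_eq_or ℤ (j : ℕ) with h | h <;> simp [h]

/-- Coefficients summing to zero, each acting injectively on groups of odd order. -/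
lemma exists_zero_sum_coeffs {n : ℕ} (hn : Odd n) (h1 : 1 < n) :
    ∃ f : Fin n → ℤ, ∑ i, f i = 0 ∧ ∀ i, f i = 1 ∨ f i = -1 ∨ f i = -2 := by
  obtain ⟨m, rfl⟩ : ∃ m, n = 3 + 2 * m := by
    obtain ⟨k, rfl⟩ := hn
    exact ⟨k - 1, by omega⟩
  obtain ⟨g, hg, hg'⟩ := exists_extend_by_signs ![1, 1, -2] m
  refine ⟨g, by rw [hg]; simp [Fin.sum_univ_three], fun i => ?_⟩
  rcases hg' i with h | h | ⟨j, h⟩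
  · exact Or.inl h
  · exact Or.inr (Or.inl h)
  · fin_cases j <;> simp_all

lemma eq_zero_of_coeff_zsmul {Γ : Type*} [AddCommGroup Γ] [Fintype Γ]
    (h : Odd (Fintype.card Γ)) {z : ℤ} (hz : z = 1 ∨ z = -1 ∨ z = -2) {g : Γ}
    (hg : z • g = 0) : g = 0 := by
  rcases hz with rfl | rfl | rfl
  · simpa using hg
  · simpa using hg
  · apply eq_zero_of_two_nsmul_eq_zero h
    rw [neg_zsmul, neg_eq_zero] at hg
    exact_mod_cast hg

lemma exists_addSubgroup_card_prime {Γ : Type*} [AddCommGroup Γ] [Fintype Γ] {p n : ℕ}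
    (hp : p.Prime) (h : Fintype.card Γ = n * p) :
    ∃ H : AddSubgroup Γ, Nat.card H = p ∧ Nat.card (Γ ⧸ H) = n := by
  have := Fact.mk hp
  obtain ⟨g, hg⟩ := exists_prime_addOrderOf_dvd_card p (h ▸ Nat.dvd_mul_left p n)
  have hH : Nat.card (AddSubgroup.zmultiples g) = p := by rw [Nat.card_zmultiples, hg]
  refine ⟨AddSubgroup.zmultiples g, hH, Nat.eq_of_mul_eq_mul_right hp.pos ?_⟩
  rw [← h, ← Nat.card_eq_fintype_card,
    AddSubgroup.card_eq_card_quotient_mul_card_addSubgroup (AddSubgroup.zmultiples g), hH]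

/-- Perturbing a lift of a bijective family over a quotient by injective functions into the
subgroup yields a bijective family. -/
lemma bijective_lift_add {Γ : Type*} [AddCommGroup Γ] [Fintype Γ] (H : AddSubgroup Γ)
    {T : Type*} [Fintype T] {x : T → Γ ⧸ H} (hx : Function.Bijective x) {r : T → Γ}
    (hr : ∀ t, (r t : Γ ⧸ H) = x t) {φ : T → H → H} (hφ : ∀ t, Function.Injective (φ t)) :
    Function.Bijective (fun q : T × H => r q.1 + φ q.1 q.2) := by
  classical
  refine (Nat.bijective_iff_injective_and_card _).2 ⟨?_, ?_⟩
  · rintro ⟨t, k⟩ ⟨t', k'⟩ h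
    dsimp only at h
    have ht : t = t' := by
      apply hx.1
      have := congrArg (QuotientAddGroup.mk : Γ → Γ ⧸ H) h
      simpa [QuotientAddGroup.mk_add, hr,
        (QuotientAddGroup.eq_zero_iff _).2 (SetLike.coe_mem _)] using this
    subst ht
    exact Prod.ext rfl (hφ t (Subtype.ext (add_left_cancel h)))
  · rw [Nat.card_prod, Nat.card_eq_of_bijective x hx,
      ← AddSubgroup.card_eq_card_quotient_mul_card_addSubgroup]

lemma HasZeroMagicSets.mul_width {a b c p : ℕ} (h : HasZeroMagicSets.{u} a b c) (ha : Odd a)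
    (ha1 : 1 < a) (hb : 0 < b) (hp : p.Prime) (hp2 : Odd p) :
    HasZeroMagicSets.{u} a (p * b) c := by
  classical
  intro Γ _ _ hΓ
  obtain ⟨H, hH, hQ⟩ := exists_addSubgroup_card_prime (n := a * b * c) hp (by rw [hΓ]; ring)
  have hHodd : Odd (Fintype.card H) := by rwa [← Nat.card_eq_fintype_card, hH]
  rw [Nat.card_eq_fintype_card] at hQ
  obtain ⟨x, hx, hxr, hxc⟩ := h (Γ ⧸ H) hQ
  have : Nonempty (Fin a) := ⟨⟨0, by omega⟩⟩
  have : Nonempty (Fin b) := ⟨⟨0, hb⟩⟩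
  choose r hr hrr hrc using fun s => exists_zero_sum_lift H (x s) (hxr s) (hxc s)
  obtain ⟨w, hw, hw'⟩ := exists_zero_sum_coeffs ha ha1
  refine exists_isMagicRectangleSet_of_types (S := Fin c) (I := Fin a) (J := H × Fin b)
    (by simp) (by simp) (by rw [Fintype.card_prod, ← Nat.card_eq_fintype_card, hH]; simp)
    (fun s i j => r s i j.2 + ((w i • j.1 : H) : Γ)) ?_ (fun s i => ?_) (fun s j => ?_)
  · have := bijective_lift_add H hx (r := fun q => r q.1 q.2.1 q.2.2) (fun q => hr _ _ _)
      (φ := fun q k => w q.2.1 • k) (fun q k k' hk => by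
        refine sub_eq_zero.1 (eq_zero_of_coeff_zsmul hHodd (hw' q.2.1) ?_)
        rw [zsmul_sub]
        exact sub_eq_zero.2 hk)
    let e : Fin c × Fin a × H × Fin b ≃ (Fin c × Fin a × Fin b) × H :=
      { toFun := fun q => ((q.1, q.2.1, q.2.2.2), q.2.2.1)
        invFun := fun q => (q.1.1, q.1.2.1, q.2, q.1.2.2)
        left_inv := fun _ => rfl
        right_inv := fun _ => rfl }
    exact this.comp e.bijective
  · rw [Fintype.sum_prod_type]
    simp only [Finset.sum_add_distrib, hrr, Finset.sum_const, zero_add]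
    rw [← Finset.smul_sum]
    have : ∑ k : H, ((w i • k : H) : Γ) = 0 := by
      rw [← AddSubgroup.val_finsetSum, ← Finset.smul_sum, sum_univ_eq_zero_of_odd_card hHodd]
      simp
    rw [this, smul_zero]
  · rw [Finset.sum_add_distrib, hrc, ← AddSubgroup.val_finsetSum, ← Finset.sum_smul, hw]
    simp

lemma HasZeroMagicSets.mul_count {a b c p : ℕ} (h : HasZeroMagicSets.{u} a b c) (ha : Odd a)
    (ha1 : 1 < a) (hb : Odd b) (hb1 : 1 < b) (hp : p.Prime) (hp2 : Odd p) :
    HasZeroMagicSets.{u} a b (p * c) := by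
  classical
  intro Γ _ _ hΓ
  obtain ⟨H, hH, hQ⟩ := exists_addSubgroup_card_prime (n := a * b * c) hp (by rw [hΓ]; ring)
  have hHodd : Odd (Fintype.card H) := by rwa [← Nat.card_eq_fintype_card, hH]
  rw [Nat.card_eq_fintype_card] at hQ
  obtain ⟨x, hx, hxr, hxc⟩ := h (Γ ⧸ H) hQ
  have : Nonempty (Fin a) := ⟨⟨0, by omega⟩⟩
  have : Nonempty (Fin b) := ⟨⟨0, by omega⟩⟩
  choose r hr hrr hrc using fun s => exists_zero_sum_lift H (x s) (hxr s) (hxc s)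
  obtain ⟨w, hw, hw'⟩ := exists_zero_sum_coeffs ha ha1
  obtain ⟨v, hv, hv'⟩ := exists_zero_sum_coeffs hb hb1
  refine exists_isMagicRectangleSet_of_types (S := H × Fin c) (I := Fin a) (J := Fin b)
    (by rw [Fintype.card_prod, ← Nat.card_eq_fintype_card, hH]; simp) (by simp) (by simp)
    (fun s i j => r s.2 i j + ((w i • v j • s.1 : H) : Γ)) ?_ (fun s i => ?_) (fun s j => ?_)
  · have := bijective_lift_add H hx (r := fun q => r q.1 q.2.1 q.2.2) (fun q => hr _ _ _)
      (φ := fun q k => w q.2.1 • v q.2.2 • k) (fun q k k' hk => by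
        refine sub_eq_zero.1 (eq_zero_of_coeff_zsmul hHodd (hv' q.2.2)
          (eq_zero_of_coeff_zsmul hHodd (hw' q.2.1) ?_))
        rw [zsmul_sub, zsmul_sub]
        exact sub_eq_zero.2 hk)
    let e : (H × Fin c) × Fin a × Fin b ≃ (Fin c × Fin a × Fin b) × H :=
      { toFun := fun q => ((q.1.2, q.2.1, q.2.2), q.1.1)
        invFun := fun q => ((q.2, q.1.1), q.1.2.1, q.1.2.2)
        left_inv := fun _ => rfl
        right_inv := fun _ => rfl }
    exact this.comp e.bijective
  · rw [Finset.sum_add_distrib, hrr, ← AddSubgroup.val_finsetSum, ← Finset.smul_sum,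
      ← Finset.sum_smul, hv]
    simp
  · rw [Finset.sum_add_distrib, hrc, ← AddSubgroup.val_finsetSum, ← Finset.sum_smul, hw]
    simp

lemma hasZeroMagicSets_prime_self {p : ℕ} (hp : p.Prime) (hp2 : Odd p) :
    HasZeroMagicSets.{u} p p 1 := by
  classical
  intro Γ _ _ hΓ
  obtain ⟨H, hH, hQ⟩ := exists_addSubgroup_card_prime (n := p) hp (by rw [hΓ]; ring)
  have hHodd : Odd (Fintype.card H) := by rwa [← Nat.card_eq_fintype_card, hH]
  rw [Nat.card_eq_fintype_card] at hQ
  have hQodd : Odd (Fintype.card (Γ ⧸ H)) := by rwa [hQ]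
  let φ : Γ ⧸ H ≃ H := Fintype.equivOfCardEq (by rw [hQ, ← Nat.card_eq_fintype_card, hH])
  -- a section of the quotient map whose values sum to zero
  obtain ⟨r, hr, hr0⟩ : ∃ r : Γ ⧸ H → Γ, (∀ q, (r q : Γ ⧸ H) = q) ∧ ∑ q, r q = 0 := by
    refine ⟨fun q => q.out - if q = 0 then ∑ k : Γ ⧸ H, k.out else 0, fun q => ?_,
      by simp [Finset.sum_sub_distrib]⟩
    dsimp only
    split_ifs
    · have : ((∑ k : Γ ⧸ H, k.out : Γ) : Γ ⧸ H) = 0 := by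
        rw [← QuotientAddGroup.mk'_apply, map_sum]
        simpa using sum_univ_eq_zero_of_odd_card hQodd
      rw [QuotientAddGroup.mk_sub, this]
      simp
    · simp
  have hφ0 : ∑ q, (φ q : Γ) = 0 := by
    rw [← AddSubgroup.val_finsetSum, Equiv.sum_comp φ (fun k => k),
      sum_univ_eq_zero_of_odd_card hHodd]
    simp
  refine exists_isMagicRectangleSet_of_types (S := Unit) (I := Γ ⧸ H) (J := Γ ⧸ H)
    (by simp) hQ hQ (fun _ i j => r (i + j) + (φ (i - j) : Γ)) ?_ (fun s i => ?_) (fun s j => ?_)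
  · have hbij : Function.Bijective (fun q : (Γ ⧸ H) × (Γ ⧸ H) => r q.1 + (φ q.2 : Γ)) := by
      have := bijective_lift_add H Function.bijective_id (r := r) hr (φ := fun _ k => k)
        (fun _ => Function.injective_id)
      exact this.comp ((Equiv.refl _).prodCongr φ).bijective
    have hrot : Function.Bijective
        (fun q : Unit × (Γ ⧸ H) × (Γ ⧸ H) => (q.2.1 + q.2.2, q.2.1 - q.2.2)) := by
      refine (Fintype.bijective_iff_injective_and_card _).2 ⟨?_, by simp⟩
      rintro ⟨_, i, j⟩ ⟨_, i', j'⟩ h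
      obtain ⟨h1, h2⟩ := Prod.ext_iff.1 h
      dsimp only at h1 h2
      have hi : i = i' := by
        refine sub_eq_zero.1 (eq_zero_of_two_nsmul_eq_zero hQodd ?_)
        calc 2 • (i - i') = (i + j) + (i - j) - ((i' + j') + (i' - j')) := by abel
          _ = 0 := by rw [h1, h2, sub_self]
      subst hi
      rw [add_left_cancel h1]
    exact hbij.comp hrot
  · rw [Finset.sum_add_distrib, ← add_zero (0 : Γ)]
    exact congrArg₂ _ ((Equiv.sum_comp (Equiv.addLeft i) r).trans hr0)
      ((Equiv.sum_comp (Equiv.subLeft i) (fun q => (φ q : Γ))).trans hφ0)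
  · rw [Finset.sum_add_distrib, ← add_zero (0 : Γ)]
    exact congrArg₂ _ ((Equiv.sum_comp (Equiv.addRight j) r).trans hr0)
      ((Equiv.sum_comp (Equiv.subRight j) (fun q => (φ q : Γ))).trans hφ0)

lemma nonempty_addEquiv_zmod_prod {Γ : Type*} [AddCommGroup Γ] [Fintype Γ] {p q : ℕ}
    (hp : p.Prime) (hq : q.Prime) (hpq : p ≠ q) (hΓ : Fintype.card Γ = p * q) :
    Nonempty (ZMod p × ZMod q ≃+ Γ) := by
  have := Fact.mk hp
  have := Fact.mk hq
  have hcop := (Nat.coprime_primes hp hq).2 hpq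
  obtain ⟨g, hg⟩ := exists_prime_addOrderOf_dvd_card (G := Γ) p ⟨q, hΓ⟩
  obtain ⟨h, hh⟩ := exists_prime_addOrderOf_dvd_card (G := Γ) q ⟨p, by rw [hΓ, mul_comm]⟩
  have ho : addOrderOf (g + h) = Nat.card Γ := by
    rw [(AddCommute.all g h).addOrderOf_add_eq_mul_addOrderOf_of_coprime (by rwa [hg, hh]),
      hg, hh, Nat.card_eq_fintype_card, hΓ]
  have e := zmodAddCyclicAddEquiv (isAddCyclic_of_addOrderOf_eq_card _ ho)
  rw [Nat.card_eq_fintype_card, hΓ] at e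
  exact ⟨(ZMod.chineseRemainder hcop).toAddEquiv.symm.trans e⟩

lemma hasZeroMagicSets_prime_lt {p q : ℕ} (hp : p.Prime) (hp2 : Odd p) (hq : q.Prime)
    (hq2 : Odd q) (hpq : p < q) : HasZeroMagicSets.{u} p q 1 := by
  classical
  intro Γ _ _ hΓ
  have := Fact.mk hp
  have := Fact.mk hq
  obtain ⟨e⟩ := nonempty_addEquiv_zmod_prod hp hq hpq.ne (by rw [hΓ, mul_one])
  obtain ⟨v, hv, hv'⟩ : ∃ v : ZMod q → ℤ, ∑ j, v j = p ∧ ∀ j, v j = 1 ∨ v j = -1 := by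
    obtain ⟨m, hm⟩ : ∃ m, q = p + 2 * m := by
      obtain ⟨k, rfl⟩ := hp2
      obtain ⟨l, rfl⟩ := hq2
      exact ⟨l - k, by omega⟩
    obtain ⟨g, hg, hg'⟩ := exists_extend_by_signs (fun _ : Fin p => (1 : ℤ)) m
    let ε : ZMod q ≃ Fin (p + 2 * m) := Fintype.equivFinOfCardEq (by rw [ZMod.card, ← hm])
    refine ⟨fun j => g (ε j), ?_, fun j => ?_⟩
    · rw [Equiv.sum_comp ε g, hg]
      simp
    · rcases hg' (ε j) with h | h | ⟨_, h⟩ <;> simp [h]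
  let w : ZMod p → ZMod q := fun i => if i = 0 then 1 - (p : ZMod q) else 1
  have hw : ∑ i, w i = 0 := by
    have : ∀ i, w i = 1 - if i = 0 then (p : ZMod q) else 0 := fun i => by
      by_cases h : i = 0 <;> simp [w, h]
    simp [this, Finset.sum_sub_distrib]
  have hw0 : ∀ i, w i ≠ 0 := by
    intro i
    by_cases h : i = 0
    · have : ((p - 1 : ℕ) : ZMod q) ≠ 0 := by
        rw [Ne, ZMod.natCast_eq_zero_iff]
        intro hd
        have := Nat.le_of_dvd (by have := hp.two_le; omega) hd
        omega
      rw [Nat.cast_sub hp.one_le, Nat.cast_one] at this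
      simp only [w, h, if_true]
      rw [← neg_sub]
      exact neg_ne_zero.2 this
    · simp [w, h]
  have hwv : ∀ i j, w ((v j : ZMod p) * i) = w i := by
    intro i j
    rcases hv' j with h | h <;> simp [w, h]
  have hsum : ∀ n [Fact n.Prime], Odd n → ∑ i : ZMod n, i = 0 := fun n _ hn =>
    sum_univ_eq_zero_of_odd_card (by rwa [ZMod.card])
  have hrow : ∀ i, ∑ j, (((v j : ZMod p) * i, w i * j) : ZMod p × ZMod q) = 0 := by
    intro i
    ext
    · rw [Prod.fst_sum, ← Finset.sum_mul, ← Int.cast_sum, hv]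
      simp
    · rw [Prod.snd_sum, ← Finset.mul_sum, hsum q hq2]
      simp
  have hcol : ∀ j, ∑ i, (((v j : ZMod p) * i, w i * j) : ZMod p × ZMod q) = 0 := by
    intro j
    ext
    · rw [Prod.fst_sum, ← Finset.mul_sum, hsum p hp2]
      simp
    · rw [Prod.snd_sum, ← Finset.sum_mul, hw]
      simp
  refine exists_isMagicRectangleSet_of_types (S := Unit) (I := ZMod p) (J := ZMod q)
    (by simp) (ZMod.card p) (ZMod.card q) (fun _ i j => e ((v j : ZMod p) * i, w i * j))
    ?_ (fun s i => ?_) (fun s j => ?_)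
  · have hbij : Function.Bijective (fun t : Unit × ZMod p × ZMod q =>
        (((v t.2.2 : ZMod p) * t.2.1, w t.2.1 * t.2.2) : ZMod p × ZMod q)) := by
      refine (Fintype.bijective_iff_injective_and_card _).2 ⟨?_, by simp⟩
      rintro ⟨_, i, j⟩ ⟨_, i', j'⟩ h
      obtain ⟨h1, h2⟩ := Prod.ext_iff.1 h
      dsimp only at h1 h2
      have h3 : w i = w i' := by rw [← hwv i j, h1, hwv]
      rw [h3] at h2
      have hj := mul_left_cancel₀ (hw0 i') h2
      subst hj
      have hi : i = i' := by
        rcases hv' j with h | h <;> simpa [h] using h1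
      rw [hi]
    exact e.bijective.comp hbij
  · rw [← map_sum, hrow, map_zero]
  · rw [← map_sum, hcol, map_zero]

lemma hasZeroMagicSets_primes {p q : ℕ} (hp : p.Prime) (hp2 : Odd p) (hq : q.Prime)
    (hq2 : Odd q) : HasZeroMagicSets.{u} p q 1 := by
  rcases lt_trichotomy p q with h | rfl | h
  · exact hasZeroMagicSets_prime_lt hp hp2 hq hq2 h
  · exact hasZeroMagicSets_prime_self hp hp2
  · exact (hasZeroMagicSets_prime_lt hq hq2 hp hp2 h).transpose

/-- Multiplicative induction over the odd numbers greater than one. -/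
lemma odd_induction {P : ℕ → Prop} (hprime : ∀ p : ℕ, p.Prime → Odd p → P p)
    (hmul : ∀ p n : ℕ, p.Prime → Odd p → Odd n → 1 < n → P n → P (p * n)) {n : ℕ}
    (hn : Odd n) (h1 : 1 < n) : P n := by
  induction n using induction_on_primes with
  | zero => simp at h1
  | one => simp at h1
  | prime_mul p k hp ih =>
    obtain ⟨hp2, hk⟩ := Nat.odd_mul.1 hn
    rcases Nat.lt_or_ge 1 k with h | h
    · exact hmul p k hp hp2 hk h (ih hk h)
    · have : k = 1 := by
        have := hk.pos
        omega
      subst this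
      simpa using hprime p hp hp2

lemma hasZeroMagicSets_of_odd {a b c : ℕ} (ha : Odd a) (ha1 : 1 < a) (hb : Odd b) (hb1 : 1 < b)
    (hc : Odd c) : HasZeroMagicSets.{u} a b c := by
  have key : HasZeroMagicSets.{u} a b 1 := by
    refine odd_induction (P := fun b => HasZeroMagicSets.{u} a b 1) (fun q hq hq2 => ?_)
      (fun q n hq hq2 hn hn1 ih => ih.mul_width ha ha1 (by omega) hq hq2) hb hb1
    exact odd_induction (P := fun a => HasZeroMagicSets.{u} a q 1)
      (fun p hp hp2 => hasZeroMagicSets_primes hp hp2 hq hq2)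
      (fun p n hp hp2 hn hn1 ih =>
        (ih.transpose.mul_width hq2 hq.one_lt (by omega) hp hp2).transpose) ha ha1
  rcases Nat.lt_or_ge 1 c with h | h
  · exact odd_induction (P := fun c => HasZeroMagicSets.{u} a b c)
      (fun p hp hp2 => by simpa using key.mul_count ha ha1 hb hb1 hp hp2)
      (fun p n hp hp2 _ _ ih => ih.mul_count ha ha1 hb hb1 hp hp2) hc h
  · have : c = 1 := by
      have := hc.pos
      omega
    rwa [this]

lemma zmod_two_eq_zero_or_one (z : ZMod 2) : z = 0 ∨ z = 1 := by
  revert z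
  decide

lemma exists_surjective_addMonoidHom_zmod_two {Γ : Type*} [AddCommGroup Γ] [Fintype Γ]
    (h : 2 ∣ Fintype.card Γ) : ∃ f : Γ →+ ZMod 2, Function.Surjective f := by
  have := Fact.mk Nat.prime_two
  let D : Γ →+ Γ := nsmulAddMonoidHom 2
  obtain ⟨t, ht⟩ := exists_prime_addOrderOf_dvd_card (G := Γ) 2 h
  have hD : ¬ Function.Surjective D := by
    rw [← Finite.injective_iff_surjective]
    intro hinj
    have h0 : D t = D 0 := by
      have := addOrderOf_nsmul_eq_zero t
      rw [ht] at this
      simpa [D] using this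
    rw [hinj h0] at ht
    simp at ht
  obtain ⟨δ, hδ⟩ : ∃ δ, δ ∉ D.range := by
    by_contra! hall
    exact hD hall
  let _ : Module (ZMod 2) (Γ ⧸ D.range) := AddCommGroup.zmodModule (n := 2) (fun q => by
    induction q using QuotientAddGroup.induction_on with
    | H g =>
      rw [← QuotientAddGroup.mk_nsmul]
      exact (QuotientAddGroup.eq_zero_iff _).2 ⟨g, rfl⟩)
  have hne : (δ : Γ ⧸ D.range) ≠ 0 := fun h => hδ ((QuotientAddGroup.eq_zero_iff _).1 h)
  obtain ⟨F, hF⟩ : ∃ F : Module.Dual (ZMod 2) (Γ ⧸ D.range), F δ ≠ 0 := by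
    by_contra! hall
    exact hne ((Module.forall_dual_apply_eq_zero_iff (ZMod 2) _).1 hall)
  have hF1 : F δ = 1 := (zmod_two_eq_zero_or_one _).resolve_left hF
  refine ⟨F.toAddMonoidHom.comp (QuotientAddGroup.mk' _), fun z => ?_⟩
  rcases zmod_two_eq_zero_or_one z with rfl | rfl
  · exact ⟨0, map_zero _⟩
  · exact ⟨δ, hF1⟩

/-- A group whose order is divisible by four splits into magic `2 × 2` squares. -/
lemma exists_magic_two_by_two {Γ : Type*} [AddCommGroup Γ] [Fintype Γ] {n : ℕ}
    (h : Fintype.card Γ = 4 * n) : ∃ (x : Fin n → Fin 2 → Fin 2 → Γ) (ω δ : Γ),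
      Function.Bijective (fun q : Fin n × Fin 2 × Fin 2 => x q.1 q.2.1 q.2.2) ∧
      (∀ s i, ∑ j, x s i j = ω) ∧ (∀ s j, ∑ i, x s i j = δ) := by
  classical
  have := Fact.mk Nat.prime_two
  obtain ⟨f, hf⟩ := exists_surjective_addMonoidHom_zmod_two (Γ := Γ) ⟨2 * n, by rw [h]; ring⟩
  obtain ⟨δ, hδ⟩ := hf 1
  have hK : Fintype.card f.ker = 2 * n := by
    have h1 := AddSubgroup.card_mul_index f.ker
    rw [AddSubgroup.index_ker, f.range_eq_top.2 hf, AddSubgroup.card_top, Nat.card_zmod,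
      Nat.card_eq_fintype_card, Nat.card_eq_fintype_card, h] at h1
    omega
  obtain ⟨t, ht⟩ := exists_prime_addOrderOf_dvd_card (G := f.ker) 2 ⟨n, hK⟩
  have htt : (t : Γ) + t = 0 := by
    have := addOrderOf_nsmul_eq_zero t
    rw [ht, two_nsmul] at this
    exact_mod_cast this
  let T := AddSubgroup.zmultiples t
  have hQ : Nat.card (f.ker ⧸ T) = n := by
    have := AddSubgroup.card_eq_card_quotient_mul_card_addSubgroup T
    rw [Nat.card_zmultiples, ht, Nat.card_eq_fintype_card, hK] at this
    omega
  let e : Fin n ≃ f.ker ⧸ T :=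
    (Fintype.equivFinOfCardEq (by rw [← Nat.card_eq_fintype_card, hQ])).symm
  let r : Fin n → Γ := fun s => ((e s).out : f.ker)
  have hr : ∀ g, f g = 0 → ∃ s, g = r s ∨ g = r s + t := by
    intro g hg
    let k : f.ker := ⟨g, hg⟩
    refine ⟨e.symm k, ?_⟩
    have h1 : ((e (e.symm k)).out : f.ker ⧸ T) = (k : f.ker ⧸ T) := by simp
    obtain ⟨m, hm⟩ := AddSubgroup.mem_zmultiples_iff.1 (QuotientAddGroup.eq.1 h1)
    have hg' : g = r (e.symm k) + m • (t : Γ) := by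
      have := congrArg (Subtype.val) hm
      simp only [AddSubgroup.coe_add, AddSubgroup.coe_neg, AddSubgroup.coe_zsmul] at this
      rw [this]
      simp [r, k]
    rcases Int.even_or_odd' m with ⟨l, rfl | rfl⟩
    · left
      rw [hg', mul_comm, mul_zsmul, two_zsmul, htt]
      simp
    · right
      rw [hg', add_zsmul, mul_comm, mul_zsmul, two_zsmul, htt]
      simp
  refine ⟨fun s => ![![r s, δ + t - r s], ![δ - r s, r s + t]], δ + t, δ, ?_, ?_, ?_⟩
  · refine (Fintype.bijective_iff_surjective_and_card _).2 ⟨fun g => ?_, ?_⟩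
    · rcases zmod_two_eq_zero_or_one (f g) with hg | hg
      · obtain ⟨s, rfl | rfl⟩ := hr g hg
        · exact ⟨(s, 0, 0), rfl⟩
        · exact ⟨(s, 1, 1), rfl⟩
      · obtain ⟨s, hs | hs⟩ := hr (δ - g) (by rw [map_sub, hg, hδ, sub_self])
        · exact ⟨(s, 1, 0), by simp [← hs]⟩
        · refine ⟨(s, 0, 1), ?_⟩
          have : r s = δ - g - t := by rw [hs]; abel
          simp only [this, Matrix.cons_val_zero, Matrix.cons_val_one]
          calc δ + (t : Γ) - (δ - g - t) = g + (t + t) := by abel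
            _ = g := by rw [htt, add_zero]
    · simp [h]
      ring
  · intro s i
    fin_cases i
    · simp
    · simp
      abel
  · intro s j
    fin_cases j
    · simp
    · simp only [Fin.sum_univ_two, Matrix.cons_val_zero, Matrix.cons_val_one, Fin.mk_one]
      calc δ + (t : Γ) - r s + (r s + t) = δ + (t + t) := by abel
        _ = δ := by rw [htt, add_zero]

lemma exists_isMagicRectangleSet_of_even {Γ : Type*} [AddCommGroup Γ] [Fintype Γ] {a b c : ℕ}
    (ha : Even a) (hb : Even b) (hΓ : Fintype.card Γ = a * b * c) :
    ∃ x : Fin c → Fin a → Fin b → Γ, IsMagicRectangleSet a b c x := by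
  obtain ⟨m, rfl⟩ := ha
  obtain ⟨n, rfl⟩ := hb
  obtain ⟨y, ω, δ, hy, hrow, hcol⟩ := exists_magic_two_by_two (Γ := Γ) (n := c * m * n)
    (by rw [hΓ]; ring)
  let e : Fin c × Fin m × Fin n ≃ Fin (c * m * n) :=
    Fintype.equivFinOfCardEq (by simp [mul_assoc])
  let E : Fin c × (Fin m × Fin 2) × (Fin n × Fin 2) ≃ Fin (c * m * n) × Fin 2 × Fin 2 :=
    Equiv.trans
      { toFun := fun q => ((q.1, q.2.1.1, q.2.2.1), q.2.1.2, q.2.2.2)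
        invFun := fun q => (q.1.1, (q.1.2.1, q.2.1), (q.1.2.2, q.2.2))
        left_inv := fun _ => rfl
        right_inv := fun _ => rfl }
      (e.prodCongr (Equiv.refl (Fin 2 × Fin 2)))
  obtain ⟨x, hx, hr, hc⟩ := exists_isMagicRectangleSet_of_types (S := Fin c)
    (I := Fin m × Fin 2) (J := Fin n × Fin 2) (c := c) (a := m + m) (b := n + n)
    (by simp) (by simp [mul_two]) (by simp [mul_two])
    (fun s i j => y (e (s, i.1, j.1)) i.2 j.2) (ω := n • ω) (δ := m • δ) (hy.comp E.bijective)
    (fun s i => by simp only [Fintype.sum_prod_type, hrow]; simp)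
    (fun s j => by simp only [Fintype.sum_prod_type, hcol]; simp)
  exact ⟨x, hx, ⟨_, hr⟩, ⟨_, hc⟩⟩

theorem MRS_of_classical (Γ : Type*) [AddCommGroup Γ] [Fintype Γ]
    (a b c : ℕ) (ha : 1 < a) (hb : 4 ≤ b)
    (hclassical : (Even a ∧ Even b) ∨ Odd (a * b * c))
    (hcard : Fintype.card Γ = a * b * c) :
    ∃ x : Fin c → Fin a → Fin b → Γ, IsMagicRectangleSet a b c x := by
  rcases hclassical with ⟨ha2, hb2⟩ | hodd
  · exact exists_isMagicRectangleSet_of_even ha2 hb2 hcard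
  · obtain ⟨hab, hc⟩ := Nat.odd_mul.1 hodd
    obtain ⟨ha2, hb2⟩ := Nat.odd_mul.1 hab
    obtain ⟨x, hx, hr, hcol⟩ := hasZeroMagicSets_of_odd ha2 ha hb2 (by omega) hc Γ hcard
    exact ⟨x, hx, ⟨0, hr⟩, ⟨0, hcol⟩⟩
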